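/- arXiv:math/0406372 — 2 statements merged into one kernel-verified Lean document; each statement's English description precedes it below -/
import Mathlib

section
/- Let a < b be real numbers and n ≥ 1 a natural number. Suppose f : ℝ → ℝ is such that for each k ≤ n+1 the k-th derivative f^{(k)} exists at every point of [a,b], and f^{(n+1)} is interval-integrable on [a,b]. Then ‖R_n‖ ≤ ((b-a)^{n+1} / (n+1)!) · ‖f^{(n+1)}‖, where both Alexiewicz norms are taken over [a,b]. -/
open MeasureTheory intervalIntegral

theorem hasDerivAt_mul_pow_div_factorial (M a x : ℝ) (n : ℕ) :
    HasDerivAt (fun y => M * (y - a) ^ (n + 1) / (Nat.factorial (n + 1) : ℝ))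
      (M * (x - a) ^ n / (Nat.factorial n : ℝ)) x := by
  have h := ((((hasDerivAt_id x).sub_const a).pow (n + 1)).const_mul M).div_const
    (Nat.factorial (n + 1) : ℝ)
  refine h.congr_deriv ?_
  have hk : (Nat.factorial n : ℝ) ≠ 0 := by positivity
  have hk' : (n : ℝ) + 1 ≠ 0 := by positivity
  simp only [Nat.factorial_succ, id, Nat.add_sub_cancel]
  push_cast
  field_simp

theorem hasDerivAt_taylor_sum (c : ℕ → ℝ) (a x : ℝ) (n : ℕ) :
    HasDerivAt (fun y => ∑ k ∈ Finset.range (n + 1), c k * (y - a) ^ k / (Nat.factorial k : ℝ))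
      (∑ k ∈ Finset.range n, c (k + 1) * (x - a) ^ k / (Nat.factorial k : ℝ)) x := by
  simp only [Finset.sum_range_succ' _ n, pow_zero]
  exact (HasDerivAt.fun_sum fun k _ =>
    hasDerivAt_mul_pow_div_factorial (c (k + 1)) a x k).add_const _

/-- If `g 0, g 1, …, g n` are successive derivatives on `[a, b]` and `g n` stays within `M` of its
value at `a`, then the `n`-th Taylor remainder of `g 0` is at most `M (x - a) ^ n / n!`. -/
theorem abs_taylor_remainder_le {a b M : ℝ} (n : ℕ) (g : ℕ → ℝ → ℝ)
    (hg : ∀ k < n, ∀ x ∈ Set.Icc a b, HasDerivAt (g k) (g (k + 1) x) x)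
    (hM : ∀ x ∈ Set.Icc a b, |g n x - g n a| ≤ M) :
    ∀ x ∈ Set.Icc a b,
      |g 0 x - ∑ k ∈ Finset.range (n + 1), g k a * (x - a) ^ k / (Nat.factorial k : ℝ)| ≤
        M * (x - a) ^ n / (Nat.factorial n : ℝ) := by
  induction n generalizing g with
  | zero => simpa using hM
  | succ n ih =>
    have hbound := ih (fun k => g (k + 1)) (fun k hk => hg (k + 1) (by omega)) hM
    have hd : ∀ x ∈ Set.Icc a b, HasDerivAt
        (fun y => g 0 y - ∑ k ∈ Finset.range (n + 1 + 1),
          g k a * (y - a) ^ k / (Nat.factorial k : ℝ))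
        (g 1 x - ∑ k ∈ Finset.range (n + 1),
          g (k + 1) a * (x - a) ^ k / (Nat.factorial k : ℝ)) x := fun x hx =>
      (hg 0 (by omega) x hx).sub (hasDerivAt_taylor_sum (fun k => g k a) a x (n + 1))
    intro x hx
    exact image_norm_le_of_norm_deriv_right_le_deriv_boundary
      (fun y hy => (hd y hy).continuousAt.continuousWithinAt)
      (fun y hy => (hd y (Set.Ico_subset_Icc_self hy)).hasDerivWithinAt)
      (by simp [Finset.sum_range_succ'])
      (fun y => hasDerivAt_mul_pow_div_factorial M a y n)
      (fun y hy => hbound y (Set.Ico_subset_Icc_self hy)) hx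

/-- Alexiewicz-norm estimate of the Taylor remainder `R_n` in terms of the
Alexiewicz norm of `f⁽ⁿ⁺¹⁾`. -/
theorem taylor_remainder_alexiewicz_estimate
    (a b : ℝ) (hab : a < b) (n : ℕ) (hn : 1 ≤ n) (f : ℝ → ℝ)
    (hderiv : ∀ k < n + 1, ∀ x ∈ Set.Icc a b,
      HasDerivAt (iteratedDeriv k f) (iteratedDeriv (k + 1) f x) x)
    (hint : IntervalIntegrable (iteratedDeriv (n + 1) f) volume a b) :
    (⨆ c : Set.Icc a b, |∫ x in a..(c : ℝ),
        (f x - ∑ k ∈ Finset.range (n + 1),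
          iteratedDeriv k f a * (x - a) ^ k / (Nat.factorial k : ℝ))|) ≤
      ((b - a) ^ (n + 1) / (Nat.factorial (n + 1) : ℝ)) *
        ⨆ c : Set.Icc a b, |∫ t in a..(c : ℝ), iteratedDeriv (n + 1) f t| := by
  have hftc : ∀ x ∈ Set.Icc a b, ∫ t in a..x, iteratedDeriv (n + 1) f t =
      iteratedDeriv n f x - iteratedDeriv n f a := by
    intro x hx
    refine integral_eq_sub_of_hasDerivAt (fun y hy => ?_) (hint.mono_set ?_)
    · rw [Set.uIcc_of_le hx.1] at hy
      exact hderiv n (by omega) y ⟨hy.1, hy.2.trans hx.2⟩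
    · rw [Set.uIcc_of_le hx.1, Set.uIcc_of_le hab.le]
      exact Set.Icc_subset_Icc_right hx.2
  have hbdd : BddAbove (Set.range fun c : Set.Icc a b =>
      |∫ t in a..(c : ℝ), iteratedDeriv (n + 1) f t|) := by
    have hcont : ContinuousOn (fun x => |iteratedDeriv n f x - iteratedDeriv n f a|)
        (Set.Icc a b) := fun x hx =>
      ((hderiv n (by omega) x hx).continuousAt.sub continuousAt_const).abs.continuousWithinAt
    obtain ⟨C, hC⟩ := isCompact_Icc.bddAbove_image hcont
    refine ⟨C, ?_⟩
    rintro _ ⟨c, rfl⟩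
    simp only [hftc c c.2]
    exact hC ⟨c, c.2, rfl⟩
  set M := ⨆ c : Set.Icc a b, |∫ t in a..(c : ℝ), iteratedDeriv (n + 1) f t|
  have hM0 : 0 ≤ M := Real.iSup_nonneg fun c => abs_nonneg _
  have hM : ∀ x ∈ Set.Icc a b, |iteratedDeriv n f x - iteratedDeriv n f a| ≤ M := by
    intro x hx
    rw [← hftc x hx]
    exact le_ciSup hbdd ⟨x, hx⟩
  have hR := abs_taylor_remainder_le n (fun k => iteratedDeriv k f)
    (fun k hk => hderiv k (by omega)) hM
  simp only [iteratedDeriv_zero] at hR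
  have : Nonempty (Set.Icc a b) := ⟨⟨a, le_rfl, hab.le⟩⟩
  refine ciSup_le fun ⟨c, hac, hcb⟩ => ?_
  have hcont : Continuous fun x : ℝ => M * (x - a) ^ n / (Nat.factorial n : ℝ) := by fun_prop
  calc |∫ x in a..c, (f x - ∑ k ∈ Finset.range (n + 1),
          iteratedDeriv k f a * (x - a) ^ k / (Nat.factorial k : ℝ))|
      ≤ ∫ x in a..c, M * (x - a) ^ n / (Nat.factorial n : ℝ) := by
        rw [← Real.norm_eq_abs]
        exact norm_integral_le_of_norm_le hac
          (Filter.Eventually.of_forall fun x hx => hR x ⟨hx.1.le, hx.2.trans hcb⟩)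
          (hcont.intervalIntegrable a c)
    _ = M * (c - a) ^ (n + 1) / (Nat.factorial (n + 1) : ℝ) := by
        rw [integral_eq_sub_of_hasDerivAt
          (fun x _ => hasDerivAt_mul_pow_div_factorial M a x n) (hcont.intervalIntegrable a c)]
        simp
    _ ≤ M * (b - a) ^ (n + 1) / (Nat.factorial (n + 1) : ℝ) := by
        have : 0 ≤ c - a := sub_nonneg.2 hac
        gcongr
    _ = (b - a) ^ (n + 1) / (Nat.factorial (n + 1) : ℝ) * M := by ring
end

section
/- Let a < b be real numbers and n ≥ 1 a natural number. Suppose f : ℝ → ℝ is such that for each k ≤ n the k-th derivative f^{(k)} exists at every point of [a,b], and f^{(n)} is interval-integrable on [a,b]. Then for all x ∈ [a,b], R_n(x) = -f^{(n)}(a)(x-a)^n/n! + (1/(n-1)!) ∫_a^x f^{(n)}(t)(x-t)^{n-1} dt. -/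
open MeasureTheory intervalIntegral

/-- Differentiating the Taylor polynomial of `f` at `x` with respect to its centre `t`. -/
theorem hasDerivAt_taylor_sum_center {f : ℝ → ℝ} {m : ℕ} {t : ℝ} (x : ℝ)
    (h : ∀ k ≤ m, HasDerivAt (iteratedDeriv k f) (iteratedDeriv (k + 1) f t) t) :
    HasDerivAt
      (fun s => ∑ k ∈ Finset.range (m + 1),
        iteratedDeriv k f s * (x - s) ^ k / (Nat.factorial k : ℝ))
      (iteratedDeriv (m + 1) f t * (x - t) ^ m / (Nat.factorial m : ℝ)) t := by
  induction m with
  | zero => simpa using h 0 le_rfl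
  | succ m ih =>
    simp only [Finset.sum_range_succ _ (m + 1)]
    have hpow : HasDerivAt (fun s : ℝ => (x - s) ^ (m + 1)) (-((m + 1 : ℝ) * (x - t) ^ m)) t := by
      simpa using ((hasDerivAt_id t).const_sub x).fun_pow (m + 1)
    refine ((ih fun k hk => h k (by omega)).fun_add
      (((h (m + 1) le_rfl).fun_mul hpow).div_const ((m + 1).factorial : ℝ))).congr_deriv ?_
    have : (m.factorial : ℝ) ≠ 0 := by positivity
    rw [Nat.factorial_succ]
    push_cast
    field_simp
    ring

/-- Integration-by-parts form of the Taylor remainder `R_n` when only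
`f⁽ⁿ⁾` is assumed integrable. -/
theorem taylor_remainder_parts_form
    (a b : ℝ) (hab : a < b) (n : ℕ) (hn : 1 ≤ n) (f : ℝ → ℝ)
    (hderiv : ∀ k < n, ∀ x ∈ Set.Icc a b,
      HasDerivAt (iteratedDeriv k f) (iteratedDeriv (k + 1) f x) x)
    (hint : IntervalIntegrable (iteratedDeriv n f) volume a b) :
    ∀ x ∈ Set.Icc a b,
      f x - (∑ k ∈ Finset.range (n + 1),
          iteratedDeriv k f a * (x - a) ^ k / (Nat.factorial k : ℝ)) =
        -(iteratedDeriv n f a * (x - a) ^ n / (Nat.factorial n : ℝ)) +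
          (1 / (Nat.factorial (n - 1) : ℝ)) *
            ∫ t in a..x, iteratedDeriv n f t * (x - t) ^ (n - 1) := by
  intro x hx
  obtain ⟨m, rfl⟩ : ∃ m, n = m + 1 := ⟨n - 1, by omega⟩
  have hsub : Set.uIcc a x ⊆ Set.Icc a b := by
    rw [Set.uIcc_of_le hx.1]
    exact Set.Icc_subset_Icc_right hx.2
  have hint' : IntervalIntegrable
      (fun t => iteratedDeriv (m + 1) f t * (x - t) ^ m / (Nat.factorial m : ℝ)) volume a x :=
    ((hint.mono_set (by rwa [Set.uIcc_of_le hab.le])).mul_continuousOn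
      (by fun_prop)).div_const _
  have hftc := integral_eq_sub_of_hasDerivAt
    (fun t ht => hasDerivAt_taylor_sum_center x
      fun k hk => hderiv k (Nat.lt_succ_of_le hk) t (hsub ht)) hint'
  have hself : ∑ k ∈ Finset.range (m + 1),
      iteratedDeriv k f x * (x - x) ^ k / (Nat.factorial k : ℝ) = f x := by
    simp [Finset.sum_range_succ']
  rw [hself, intervalIntegral.integral_div] at hftc
  rw [Finset.sum_range_succ, Nat.add_sub_cancel, one_div_mul_eq_div, hftc]
  ring
end
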